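/- arXiv:2412.10014 — 5 statements merged into one kernel-verified Lean document; each statement's English description precedes it below -/
import Mathlib

section
/- Let f : ℝⁿ → ℝⁿ be locally Lipschitz and let φ(t, x₀) denote the unique solution of ẋ = f(x) with φ(0, x₀) = x₀. Suppose Ω ⊆ ℝⁿ is a non-empty compact positively invariant set (so all solutions starting in Ω are defined for all t ≥ 0), A ⊆ ℝⁿ is a non-empty negatively invariant set, and V is a C¹ function defined on a set containing Ω \ A such that ∇V(x)·f(x) ≠ 0 for all x ∈ Ω \ A. Let M be the largest invariant set contained in cl(A) ∩ Ω. Then ω(x₀) ⊆ M for every x₀ ∈ Ω. -/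
open Filter Topology Set Metric Bornology

/-- The ω-limit set of `x₀` under the flow `φ`: points `y` approached by `φ x₀ (t k)`
along some sequence `t k → +∞` of nonnegative times. -/
def omegaLimitSet {E : Type*} [TopologicalSpace E] (φ : E → ℝ → E) (x₀ : E) : Set E :=
  {y | ∃ u : ℕ → ℝ, (∀ k, 0 ≤ u k) ∧ Filter.Tendsto u Filter.atTop Filter.atTop ∧
    Filter.Tendsto (fun k => φ x₀ (u k)) Filter.atTop (nhds y)}

lemma omegaLimitSet_subset_of_isClosed {E : Type*} [TopologicalSpace E] {φ : E → ℝ → E}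
    {Ω : Set E} (hΩc : IsClosed Ω) {x : E} (hx : ∀ t, 0 ≤ t → φ x t ∈ Ω) : omegaLimitSet φ x ⊆ Ω := by
  rintro y ⟨u, hu0, -, huy⟩
  exact hΩc.mem_of_tendsto huy (Eventually.of_forall fun k => hx _ (hu0 k))

section Semiflow

variable {E : Type*} [NormedAddCommGroup E] [NormedSpace ℝ E] {f : E → E} {φ : E → ℝ → E}

lemma continuousOn_Icc_of_solution (hφd : ∀ x t, 0 ≤ t → HasDerivAt (φ x) (f (φ x t)) t)
    (x : E) (t : ℝ) : ContinuousOn (φ x) (Icc 0 t) :=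
  fun s hs => (hφd x s hs.1).continuousAt.continuousWithinAt

lemma solution_add {K : NNReal} {Ω : Set E} (hφ0 : ∀ x, φ x 0 = x)
    (hφd : ∀ x t, 0 ≤ t → HasDerivAt (φ x) (f (φ x t)) t)
    (hK : LipschitzOnWith K f Ω) (hΩ : ∀ x ∈ Ω, ∀ t, 0 ≤ t → φ x t ∈ Ω)
    {x : E} (hx : x ∈ Ω) {s t : ℝ} (hs : 0 ≤ s) (ht : 0 ≤ t) :
    φ (φ x s) t = φ x (s + t) := by
  have hd : ∀ r, 0 ≤ r → HasDerivAt (fun r => φ x (s + r)) (f (φ x (s + r))) r := fun r hr =>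
    (hφd x (s + r) (add_nonneg hs hr)).comp_const_add s r
  exact ODE_solution_unique_of_mem_Icc_right (v := fun _ => f) (s := fun _ => Ω) (K := K)
    (fun _ _ => hK) (continuousOn_Icc_of_solution hφd _ t)
    (fun r hr => (hφd _ r hr.1).hasDerivWithinAt)
    (fun r hr => hΩ _ (hΩ x hx s hs) r hr.1)
    (fun r hr => (hd r hr.1).continuousAt.continuousWithinAt)
    (fun r hr => (hd r hr.1).hasDerivWithinAt)
    (fun r hr => hΩ x hx _ (add_nonneg hs hr.1)) (by simp [hφ0]) (right_mem_Icc.2 ht)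

lemma tendsto_solution {K : NNReal} {Ω : Set E} (hφ0 : ∀ x, φ x 0 = x)
    (hφd : ∀ x t, 0 ≤ t → HasDerivAt (φ x) (f (φ x t)) t)
    (hK : LipschitzOnWith K f Ω) (hΩ : ∀ x ∈ Ω, ∀ t, 0 ≤ t → φ x t ∈ Ω)
    {w : ℕ → E} {y : E} (hw : ∀ k, w k ∈ Ω) (hy : y ∈ Ω) (hwy : Tendsto w atTop (𝓝 y))
    {t : ℝ} (ht : 0 ≤ t) : Tendsto (fun k => φ (w k) t) atTop (𝓝 (φ y t)) := by
  rw [tendsto_iff_dist_tendsto_zero] at hwy ⊢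
  refine squeeze_zero (fun _ => dist_nonneg) (fun k => ?_)
    (by simpa only [zero_mul] using hwy.mul_const (Real.exp (K * (t - 0))))
  exact dist_le_of_trajectories_ODE_of_mem (v := fun _ => f) (s := fun _ => Ω)
    (fun _ _ => hK) (continuousOn_Icc_of_solution hφd _ t)
    (fun r hr => (hφd _ r hr.1).hasDerivWithinAt) (fun r hr => hΩ _ (hw k) r hr.1)
    (continuousOn_Icc_of_solution hφd _ t)
    (fun r hr => (hφd _ r hr.1).hasDerivWithinAt) (fun r hr => hΩ _ hy r hr.1)
    (by rw [hφ0, hφ0]) t (right_mem_Icc.2 ht)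

lemma solution_initial_injective (hf : LocallyLipschitz f) (hφ0 : ∀ x, φ x 0 = x)
    (hφd : ∀ x t, 0 ≤ t → HasDerivAt (φ x) (f (φ x t)) t)
    {t : ℝ} (ht : 0 ≤ t) : Function.Injective (fun x => φ x t) := by
  intro x y hxy
  obtain ⟨K, hK⟩ := LocallyLipschitzOn.exists_lipschitzOnWith_of_compact
    ((isCompact_Icc.image_of_continuousOn (continuousOn_Icc_of_solution hφd x t)).union
      (isCompact_Icc.image_of_continuousOn (continuousOn_Icc_of_solution hφd y t)))
    hf.locallyLipschitzOn
  have h := ODE_solution_unique_of_mem_Icc_left (v := fun _ => f) (s := fun _ => _)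
    (fun _ _ => hK) (continuousOn_Icc_of_solution hφd x t)
    (fun r hr => (hφd _ r hr.1.le).hasDerivWithinAt)
    (fun r hr => Or.inl (mem_image_of_mem _ (Ioc_subset_Icc_self hr)))
    (continuousOn_Icc_of_solution hφd y t)
    (fun r hr => (hφd _ r hr.1.le).hasDerivWithinAt)
    (fun r hr => Or.inr (mem_image_of_mem _ (Ioc_subset_Icc_self hr))) hxy (left_mem_Icc.2 ht)
  simpa [hφ0] using h

lemma omegaLimitSet_positively_invariant {K : NNReal} {Ω : Set E} (hΩc : IsClosed Ω)
    (hφ0 : ∀ x, φ x 0 = x) (hφd : ∀ x t, 0 ≤ t → HasDerivAt (φ x) (f (φ x t)) t)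
    (hK : LipschitzOnWith K f Ω) (hΩ : ∀ x ∈ Ω, ∀ t, 0 ≤ t → φ x t ∈ Ω)
    {x y : E} (hx : x ∈ Ω) (hy : y ∈ omegaLimitSet φ x) {t : ℝ} (ht : 0 ≤ t) :
    φ y t ∈ omegaLimitSet φ x := by
  have hyΩ := omegaLimitSet_subset_of_isClosed hΩc (hΩ x hx) hy
  obtain ⟨u, hu0, hu, huy⟩ := hy
  refine ⟨fun k => u k + t, fun k => add_nonneg (hu0 k) ht,
    tendsto_atTop_add_const_right _ t hu, ?_⟩
  simpa only [solution_add hφ0 hφd hK hΩ hx (hu0 _) ht] using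
    tendsto_solution hφ0 hφd hK hΩ (fun k => hΩ x hx _ (hu0 k)) hyΩ huy ht

lemma exists_mem_omegaLimitSet_solution_eq {K : NNReal} {Ω : Set E} (hΩc : IsCompact Ω)
    (hφ0 : ∀ x, φ x 0 = x) (hφd : ∀ x t, 0 ≤ t → HasDerivAt (φ x) (f (φ x t)) t)
    (hK : LipschitzOnWith K f Ω) (hΩ : ∀ x ∈ Ω, ∀ t, 0 ≤ t → φ x t ∈ Ω)
    {x z : E} (hx : x ∈ Ω) (hz : z ∈ omegaLimitSet φ x) {t : ℝ} (ht : 0 ≤ t) :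
    ∃ w ∈ omegaLimitSet φ x, φ w t = z := by
  obtain ⟨u, hu0, hu, huz⟩ := hz
  let v : ℕ → ℝ := fun k => max (u k - t) 0
  have hv0 : ∀ k, 0 ≤ v k := fun k => le_max_right _ _
  have hv : Tendsto v atTop atTop :=
    tendsto_atTop_mono (fun k => le_max_left _ _) (tendsto_atTop_add_const_right _ (-t) hu)
  obtain ⟨w, hw, ψ, hψ, hψw⟩ := hΩc.tendsto_subseq (fun k => hΩ x hx _ (hv0 k))
  refine ⟨w, ⟨v ∘ ψ, fun k => hv0 _, hv.comp hψ.tendsto_atTop, hψw⟩, ?_⟩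
  refine tendsto_nhds_unique
    (tendsto_solution hφ0 hφd hK hΩ (fun k => hΩ x hx _ (hv0 (ψ k))) hw hψw ht)
    ((huz.comp hψ.tendsto_atTop).congr' ?_)
  filter_upwards [(hu.comp hψ.tendsto_atTop).eventually_ge_atTop t] with k hk
  have hvk : v (ψ k) = u (ψ k) - t := max_eq_left (sub_nonneg.2 hk)
  change φ x (u (ψ k)) = φ (φ x (v (ψ k))) t
  rw [solution_add hφ0 hφd hK hΩ hx (hv0 (ψ k)) ht, hvk, sub_add_cancel]

end Semiflow

lemma MonotoneOn.le_of_tendsto_seq {g : ℝ → ℝ} {T a b : ℝ} (hg : MonotoneOn g (Ici T))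
    {u v : ℕ → ℝ} (hu : Tendsto u atTop atTop) (hv : Tendsto v atTop atTop)
    (ha : Tendsto (fun k => g (u k)) atTop (𝓝 a)) (hb : Tendsto (fun k => g (v k)) atTop (𝓝 b)) :
    a ≤ b := by
  refine le_of_tendsto ha ?_
  filter_upwards [hu.eventually_ge_atTop T] with k hk
  refine ge_of_tendsto hb ?_
  filter_upwards [hv.eventually_ge_atTop (u k)] with l hl
  exact hg hk (le_trans (mem_Ici.1 hk) hl) hl

/-- A function on a half-line whose derivative never vanishes has at most one limit along
sequences tending to infinity. -/
lemma eq_of_tendsto_seq_of_deriv_ne_zero {g g' : ℝ → ℝ} {T a b : ℝ}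
    (hg : ∀ t ∈ Ici T, HasDerivAt g (g' t) t) (hg' : ∀ t ∈ Ici T, g' t ≠ 0)
    {u v : ℕ → ℝ} (hu : Tendsto u atTop atTop) (hv : Tendsto v atTop atTop)
    (ha : Tendsto (fun k => g (u k)) atTop (𝓝 a)) (hb : Tendsto (fun k => g (v k)) atTop (𝓝 b)) :
    a = b := by
  have hc : ContinuousOn g (Ici T) := fun t ht => (hg t ht).continuousAt.continuousWithinAt
  rcases hasDerivWithinAt_forall_lt_or_forall_gt_of_forall_ne (convex_Ici T)
    (fun t ht => (hg t ht).hasDerivWithinAt) hg' with h | h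
  · have hm : MonotoneOn (-g) (Ici T) := monotoneOn_of_hasDerivWithinAt_nonneg
      (f' := fun t => -g' t) (convex_Ici T) hc.neg
      (fun t ht => (hg t (interior_subset ht)).neg.hasDerivWithinAt)
      (fun t ht => neg_nonneg.2 (h t (interior_subset ht)).le)
    exact le_antisymm (neg_le_neg_iff.1 (hm.le_of_tendsto_seq hv hu hb.neg ha.neg))
      (neg_le_neg_iff.1 (hm.le_of_tendsto_seq hu hv ha.neg hb.neg))
  · have hm : MonotoneOn g (Ici T) := monotoneOn_of_hasDerivWithinAt_nonneg
      (convex_Ici T) hc (fun t ht => (hg t (interior_subset ht)).hasDerivWithinAt)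
      (fun t ht => (h t (interior_subset ht)).le)
    exact le_antisymm (hm.le_of_tendsto_seq hu hv ha hb) (hm.le_of_tendsto_seq hv hu hb ha)

/-- Theorem 1: if `Ω` is a nonempty compact positively invariant set, `A` a nonempty
negatively invariant set, and `V` is `C¹` on an open set containing `Ω \ A` with
`∇V(x)·f(x) ≠ 0` on `Ω \ A`, then for every `x₀ ∈ Ω` the ω-limit set of `x₀` is contained
in the largest invariant set `M` contained in `closure A ∩ Ω`. -/
theorem omega_limit_subset_largest_invariant_in_closure_inter {n : ℕ}
    (f : EuclideanSpace ℝ (Fin n) → EuclideanSpace ℝ (Fin n))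
    (hf : LocallyLipschitz f)
    (φ : EuclideanSpace ℝ (Fin n) → ℝ → EuclideanSpace ℝ (Fin n))
    (hφ0 : ∀ x, φ x 0 = x)
    (hφd : ∀ x t, 0 ≤ t → HasDerivAt (φ x) (f (φ x t)) t)
    (Ω A U : Set (EuclideanSpace ℝ (Fin n)))
    (hΩne : Ω.Nonempty) (hΩcomp : IsCompact Ω)
    (hΩpos : ∀ x ∈ Ω, ∀ t, 0 ≤ t → φ x t ∈ Ω)
    (hAne : A.Nonempty)
    (hAneg : ∀ x t, 0 ≤ t → φ x t ∈ A → x ∈ A)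
    (hUopen : IsOpen U) (hΩAU : Ω \ A ⊆ U)
    (V : EuclideanSpace ℝ (Fin n) → ℝ)
    (hV : ContDiffOn ℝ 1 V U)
    (hVf : ∀ x ∈ Ω \ A, fderiv ℝ V x (f x) ≠ 0)
    (x₀ : EuclideanSpace ℝ (Fin n)) (hx₀ : x₀ ∈ Ω) :
    omegaLimitSet φ x₀ ⊆
      ⋃₀ {I : Set (EuclideanSpace ℝ (Fin n)) | I ⊆ closure A ∩ Ω ∧
        (∀ x ∈ I, ∀ t, 0 ≤ t → φ x t ∈ I) ∧
        (∀ x t, 0 ≤ t → φ x t ∈ I → x ∈ I)} := by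
  obtain ⟨K, hK⟩ :=
    LocallyLipschitzOn.exists_lipschitzOnWith_of_compact hΩcomp (hf.locallyLipschitzOn (s := Ω))
  have hωΩ : omegaLimitSet φ x₀ ⊆ Ω :=
    omegaLimitSet_subset_of_isClosed hΩcomp.isClosed (hΩpos x₀ hx₀)
  have hpos : ∀ x ∈ omegaLimitSet φ x₀, ∀ t, 0 ≤ t → φ x t ∈ omegaLimitSet φ x₀ :=
    fun x hx t ht => omegaLimitSet_positively_invariant hΩcomp.isClosed hφ0 hφd hK hΩpos hx₀ hx ht
  have hneg : ∀ x t, 0 ≤ t → φ x t ∈ omegaLimitSet φ x₀ → x ∈ omegaLimitSet φ x₀ := by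
    intro x t ht hx
    obtain ⟨w, hw, hwt⟩ :=
      exists_mem_omegaLimitSet_solution_eq hΩcomp hφ0 hφd hK hΩpos hx₀ hx ht
    rwa [← solution_initial_injective hf hφ0 hφd ht hwt]
  refine subset_sUnion_of_mem ⟨fun y hy => ⟨?_, hωΩ hy⟩, hpos, hneg⟩
  by_cases hA : ∀ t, 0 ≤ t → φ x₀ t ∈ A
  · exact omegaLimitSet_subset_of_isClosed isClosed_closure
      (fun t ht => subset_closure (hA t ht)) hy
  push Not at hA
  obtain ⟨T, hT0, hT⟩ := hA
  have htraj : ∀ t ∈ Ici T, φ x₀ t ∈ Ω \ A := by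
    refine fun t ht => ⟨hΩpos x₀ hx₀ t (hT0.trans ht), fun h => hT ?_⟩
    refine hAneg _ (t - T) (sub_nonneg.2 ht) ?_
    rwa [solution_add hφ0 hφd hK hΩpos hx₀ hT0 (sub_nonneg.2 ht), add_sub_cancel]
  have hVd : ∀ x ∈ Ω \ A, HasFDerivAt V (fderiv ℝ V x) x := fun x hx =>
    ((hV.differentiableOn one_ne_zero).differentiableAt
      (hUopen.mem_nhds (hΩAU hx))).hasFDerivAt
  have hconst : ∀ z ∈ omegaLimitSet φ x₀, z ∉ A → ∀ w ∈ omegaLimitSet φ x₀, w ∉ A →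
      V z = V w := by
    rintro z hz hzA w hw hwA
    have hzV := (hVd z ⟨hωΩ hz, hzA⟩).continuousAt.tendsto
    have hwV := (hVd w ⟨hωΩ hw, hwA⟩).continuousAt.tendsto
    obtain ⟨u, -, hu, huz⟩ := hz
    obtain ⟨v, -, hv, hvw⟩ := hw
    exact eq_of_tendsto_seq_of_deriv_ne_zero (g := V ∘ φ x₀)
      (fun t ht => (hVd _ (htraj t ht)).comp_hasDerivAt t (hφd x₀ t (hT0.trans ht)))
      (fun t ht => hVf _ (htraj t ht)) hu hv (hzV.comp huz) (hwV.comp hvw)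
  by_contra hyA
  have hyA' : y ∉ A := fun h => hyA (subset_closure h)
  have hd : HasDerivAt (V ∘ φ y) (fderiv ℝ V y (f y)) 0 := by
    have h := hVd y ⟨hωΩ hy, hyA'⟩
    have h' := hφd y 0 le_rfl
    rw [hφ0] at h'
    exact HasFDerivAt.comp_hasDerivAt 0 (by rwa [hφ0]) h'
  have hnear : ∀ᶠ t in 𝓝[≥] (0 : ℝ), φ y t ∈ (closure A)ᶜ :=
    ((hφd y 0 le_rfl).continuousAt.eventually_mem
      (isClosed_closure.isOpen_compl.mem_nhds (by rwa [hφ0]))).filter_mono nhdsWithin_le_nhds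
  have heq : V ∘ φ y =ᶠ[𝓝[≥] 0] fun _ => V y := by
    filter_upwards [hnear, self_mem_nhdsWithin] with t ht ht0
    exact hconst _ (hpos y hy t ht0) (fun h => ht (subset_closure h)) y hy hyA'
  refine hVf y ⟨hωΩ hy, hyA'⟩ ((uniqueDiffWithinAt_Ici (0 : ℝ)).eq_deriv _ hd.hasDerivWithinAt ?_)
  exact (hasDerivWithinAt_const 0 (Ici 0) (V y)).congr_of_eventuallyEq heq (by simp [hφ0])
end

section
/- Let f : ℝⁿ → ℝⁿ be locally Lipschitz and let φ(t, x₀) denote the unique solution of ẋ = f(x) with φ(0, x₀) = x₀. Suppose the positive orbit γ⁺(x₀) = {φ(t, x₀) : t ≥ 0} is bounded (in particular the solution exists for all t ≥ 0). Let V : ℝⁿ → ℝ be any C¹ function and define S = {x ∈ ℝⁿ : ∇V(x)·f(x) = 0}. Then ω(x₀) ∩ S ≠ ∅. -/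
open Filter Topology Set Metric Bornology

/-- A function with bounded values on `[0, ∞)` has a derivative tending to `0` along some
sequence of times tending to `+∞`. -/
theorem exists_seq_tendsto_deriv_zero_of_abs_le {g g' : ℝ → ℝ} {M : ℝ}
    (hg : ∀ t, 0 ≤ t → HasDerivAt g (g' t) t) (hM : ∀ t, 0 ≤ t → |g t| ≤ M) :
    ∃ u : ℕ → ℝ, (∀ k, 0 ≤ u k) ∧ Tendsto u atTop atTop ∧
      Tendsto (fun k => g' (u k)) atTop (𝓝 0) := by
  have hmean : ∀ k : ℕ, ∃ t : ℝ, (k : ℝ) ≤ t ∧ |g' t| ≤ 2 * M / ((k : ℝ) + 1) := by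
    intro k
    have hk : (0 : ℝ) ≤ k := k.cast_nonneg
    obtain ⟨t, ht, hslope⟩ := exists_hasDerivAt_eq_slope g g'
      (show (k : ℝ) < k + (k + 1) by linarith)
      (fun t ht => (hg t (hk.trans ht.1)).continuousAt.continuousWithinAt)
      (fun t ht => hg t (hk.trans ht.1.le))
    refine ⟨t, ht.1.le, ?_⟩
    rw [hslope, add_sub_cancel_left, abs_div, abs_of_pos (by linarith : (0 : ℝ) < k + 1)]
    gcongr
    have h₁ := hM (k + (k + 1)) (by linarith)
    have h₂ := hM k hk
    rw [abs_le] at h₁ h₂ ⊢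
    constructor <;> linarith
  choose u hu hu' using hmean
  refine ⟨u, fun k => k.cast_nonneg.trans (hu k),
    tendsto_atTop_mono hu tendsto_natCast_atTop_atTop, squeeze_zero_norm hu' ?_⟩
  simpa [div_eq_mul_inv] using
    (tendsto_one_div_add_atTop_nhds_zero_nat (𝕜 := ℝ)).const_mul (2 * M)

/-- Theorem 2 (first part): if the positive orbit of `x₀` is bounded and `V` is any `C¹`
function, then the ω-limit set of `x₀` meets `S = {x : ∇V(x)·f(x) = 0}`. -/
theorem omega_limit_inter_zero_derivative_set_nonempty {n : ℕ}
    (f : EuclideanSpace ℝ (Fin n) → EuclideanSpace ℝ (Fin n))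
    (hf : LocallyLipschitz f)
    (φ : EuclideanSpace ℝ (Fin n) → ℝ → EuclideanSpace ℝ (Fin n))
    (hφ0 : ∀ x, φ x 0 = x)
    (hφd : ∀ x t, 0 ≤ t → HasDerivAt (φ x) (f (φ x t)) t)
    (x₀ : EuclideanSpace ℝ (Fin n))
    (hbound : IsBounded (φ x₀ '' Ici (0:ℝ)))
    (V : EuclideanSpace ℝ (Fin n) → ℝ)
    (hV : ContDiff ℝ 1 V) :
    (omegaLimitSet φ x₀ ∩ {x | fderiv ℝ V x (f x) = 0}).Nonempty := by
  have hK : IsCompact (closure (φ x₀ '' Ici (0 : ℝ))) := hbound.isCompact_closure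
  have hmem : ∀ t, 0 ≤ t → φ x₀ t ∈ closure (φ x₀ '' Ici (0 : ℝ)) :=
    fun t ht => subset_closure (mem_image_of_mem _ ht)
  obtain ⟨M, hM⟩ := hK.exists_bound_of_continuousOn hV.continuous.continuousOn
  obtain ⟨u, hu0, hu, hlim⟩ := exists_seq_tendsto_deriv_zero_of_abs_le
    (g := V ∘ φ x₀) (g' := fun t => fderiv ℝ V (φ x₀ t) (f (φ x₀ t)))
    (fun t ht => ((hV.differentiable one_ne_zero) (φ x₀ t)).hasFDerivAt.comp_hasDerivAt t
      (hφd x₀ t ht))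
    (fun t ht => hM _ (hmem t ht))
  obtain ⟨y, -, ψ, hψ, hy⟩ := hK.tendsto_subseq fun k => hmem (u k) (hu0 k)
  have hcont : Continuous fun x => fderiv ℝ V x (f x) :=
    (hV.continuous_fderiv one_ne_zero).clm_apply hf.continuous
  exact ⟨y, ⟨u ∘ ψ, fun k => hu0 (ψ k), hu.comp hψ.tendsto_atTop, hy⟩,
    tendsto_nhds_unique ((hcont.tendsto y).comp hy) (hlim.comp hψ.tendsto_atTop)⟩
end

section
/- Let f : ℝⁿ → ℝⁿ be locally Lipschitz and let φ(t, x₀) denote the unique solution of ẋ = f(x) with φ(0, x₀) = x₀. Suppose the positive orbit γ⁺(x₀) = {φ(t, x₀) : t ≥ 0} is bounded. Let V : ℝⁿ → ℝ be C¹, let S = {x ∈ ℝⁿ : ∇V(x)·f(x) = 0}, and let A = {x ∈ ℝⁿ : ∃ t ≥ 0 with φ(t, x) ∈ S}. Let M be the largest invariant set contained in cl(A). Then ω(x₀) ⊆ M. -/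
open Filter Topology Set Metric Bornology

/-- Continuous dependence of the endpoint of an integral curve of `f` on its initial value, with an
estimate uniform over all integral curves staying in a given bounded set. -/
theorem LocallyLipschitz.exists_dist_endpoint_le {E : Type*} [NormedAddCommGroup E]
    [NormedSpace ℝ E] [ProperSpace E] {f : E → E} (hf : LocallyLipschitz f) {T : ℝ} (hT : 0 ≤ T)
    {x : ℝ → E} (hx : ∀ t ∈ Icc 0 T, HasDerivAt x (f (x t)) t) {B : Set E} (hB : IsBounded B) :
    ∃ C : ℝ, ∀ y : ℝ → E, (∀ t ∈ Icc 0 T, HasDerivAt y (f (y t)) t) → (∀ t ∈ Icc 0 T, y t ∈ B) →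
      dist (y T) (x T) ≤ dist (y 0) (x 0) * C := by
  have hxc : ContinuousOn x (Icc 0 T) := fun t ht => (hx t ht).continuousAt.continuousWithinAt
  have hcpt : IsCompact (closure B ∪ x '' Icc 0 T) :=
    hB.isCompact_closure.union (isCompact_Icc.image_of_continuousOn hxc)
  obtain ⟨K, hK⟩ := LocallyLipschitzOn.exists_lipschitzOnWith_of_compact hcpt
    (hf.locallyLipschitzOn (s := closure B ∪ x '' Icc 0 T))
  refine ⟨Real.exp (K * (T - 0)), fun y hy hyB => ?_⟩
  exact dist_le_of_trajectories_ODE_of_mem (v := fun _ => f)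
    (s := fun _ => closure B ∪ x '' Icc 0 T) (fun _ _ => hK)
    (fun t ht => (hy t ht).continuousAt.continuousWithinAt)
    (fun t ht => (hy t (Ico_subset_Icc_self ht)).hasDerivWithinAt)
    (fun t ht => Or.inl (subset_closure (hyB t (Ico_subset_Icc_self ht))))
    hxc (fun t ht => (hx t (Ico_subset_Icc_self ht)).hasDerivWithinAt)
    (fun t ht => Or.inr (mem_image_of_mem x (Ico_subset_Icc_self ht))) le_rfl T
    (right_mem_Icc.2 hT)

theorem LocallyLipschitz.tendsto_endpoint {E : Type*} [NormedAddCommGroup E]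
    [NormedSpace ℝ E] [ProperSpace E] {f : E → E} (hf : LocallyLipschitz f) {T : ℝ} (hT : 0 ≤ T)
    {x : ℝ → E} (hx : ∀ t ∈ Icc 0 T, HasDerivAt x (f (x t)) t) {B : Set E} (hB : IsBounded B)
    {ι : Type*} {l : Filter ι} {y : ι → ℝ → E}
    (hy : ∀ᶠ k in l, ∀ t ∈ Icc 0 T, HasDerivAt (y k) (f (y k t)) t)
    (hyB : ∀ᶠ k in l, ∀ t ∈ Icc 0 T, y k t ∈ B) (h0 : Tendsto (fun k => y k 0) l (𝓝 (x 0))) :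
    Tendsto (fun k => y k T) l (𝓝 (x T)) := by
  obtain ⟨C, hC⟩ := hf.exists_dist_endpoint_le hT hx hB
  rw [tendsto_iff_dist_tendsto_zero] at h0 ⊢
  refine squeeze_zero' (Eventually.of_forall fun _ => dist_nonneg) ?_
    (by simpa using h0.mul_const C)
  filter_upwards [hy, hyB] with k h1 h2 using hC (y k) h1 h2

theorem exists_tendsto_of_deriv_ne_zero_of_isBounded {g g' : ℝ → ℝ} {s : ℝ}
    (hg : ∀ t, s ≤ t → HasDerivAt g (g' t) t) (hg' : ∀ t, s ≤ t → g' t ≠ 0)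
    (hb : IsBounded (g '' Ici s)) : ∃ c, Tendsto g atTop (𝓝 c) := by
  have hc : ContinuousOn g (Ici s) := fun t ht => (hg t ht).continuousAt.continuousWithinAt
  have hd : DifferentiableOn ℝ g (interior (Ici s)) := fun t ht =>
    (hg t (interior_subset ht)).differentiableAt.differentiableWithinAt
  have heq : (fun t => g (max t s)) =ᶠ[atTop] g := by
    filter_upwards [eventually_ge_atTop s] with t ht
    rw [max_eq_left ht]
  have hsub : range (fun t => g (max t s)) ⊆ g '' Ici s := by
    rintro _ ⟨t, rfl⟩
    exact mem_image_of_mem g (le_max_right t s)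
  have hmax : Monotone fun t : ℝ => max t s := fun a b h => max_le_max_right s h
  rcases hasDerivWithinAt_forall_lt_or_forall_gt_of_forall_ne (convex_Ici s)
    (fun t ht => (hg t ht).hasDerivWithinAt) hg' with h | h
  · have hm := antitoneOn_of_deriv_nonpos (convex_Ici s) hc hd fun t ht => by
      rw [(hg t (interior_subset ht)).deriv]
      exact (h t (interior_subset ht)).le
    have hm' : Antitone fun t => g (max t s) := fun a b hab =>
      hm (le_max_right a s) (le_max_right b s) (hmax hab)
    exact ⟨_, (tendsto_atTop_ciInf hm' (hb.subset hsub).bddBelow).congr' heq⟩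
  · have hm := monotoneOn_of_deriv_nonneg (convex_Ici s) hc hd fun t ht => by
      rw [(hg t (interior_subset ht)).deriv]
      exact (h t (interior_subset ht)).le
    have hm' : Monotone fun t => g (max t s) := fun a b hab =>
      hm (le_max_right a s) (le_max_right b s) (hmax hab)
    exact ⟨_, (tendsto_atTop_ciSup hm' (hb.subset hsub).bddAbove).congr' heq⟩

section Semiflow

variable {E : Type*} [NormedAddCommGroup E] [NormedSpace ℝ E] [ProperSpace E] {f : E → E}
  {φ : E → ℝ → E}

theorem semiflow_add (hf : LocallyLipschitz f) (hφ0 : ∀ x, φ x 0 = x)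
    (hφd : ∀ x t, 0 ≤ t → HasDerivAt (φ x) (f (φ x t)) t) (x : E) {s t : ℝ} (hs : 0 ≤ s)
    (ht : 0 ≤ t) : φ x (s + t) = φ (φ x s) t := by
  have hy : ∀ r ∈ Icc 0 t, HasDerivAt (fun r => φ x (s + r)) (f (φ x (s + r))) r := fun r hr =>
    (hφd x (s + r) (add_nonneg hs hr.1)).comp_const_add s r
  have hB : IsBounded ((fun r => φ x (s + r)) '' Icc 0 t) :=
    (isCompact_Icc.image_of_continuousOn fun r hr =>
      (hy r hr).continuousAt.continuousWithinAt).isBounded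
  obtain ⟨C, hC⟩ := hf.exists_dist_endpoint_le ht
    (fun r (hr : r ∈ Icc 0 t) => hφd (φ x s) r hr.1) hB
  have := hC _ hy fun r hr => mem_image_of_mem _ hr
  simp only [add_zero, hφ0, dist_self, zero_mul] at this
  exact dist_le_zero.1 this

theorem omegaLimitSet_forward_invariant (hf : LocallyLipschitz f) (hφ0 : ∀ x, φ x 0 = x)
    (hφd : ∀ x t, 0 ≤ t → HasDerivAt (φ x) (f (φ x t)) t) {x₀ : E}
    (hbound : IsBounded (φ x₀ '' Ici (0 : ℝ))) {y : E} (hy : y ∈ omegaLimitSet φ x₀) {t : ℝ}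
    (ht : 0 ≤ t) : φ y t ∈ omegaLimitSet φ x₀ := by
  obtain ⟨u, hu0, hu, hlim⟩ := hy
  refine ⟨fun k => u k + t, fun k => add_nonneg (hu0 k) ht,
    tendsto_atTop_add_const_right _ t hu, ?_⟩
  refine hf.tendsto_endpoint ht (x := φ y) (y := fun k r => φ x₀ (u k + r))
    (fun r hr => hφd y r hr.1) hbound
    (Eventually.of_forall fun k r hr =>
      (hφd x₀ (u k + r) (add_nonneg (hu0 k) hr.1)).comp_const_add (u k) r)
    (Eventually.of_forall fun k r hr => mem_image_of_mem _ (add_nonneg (hu0 k) hr.1)) ?_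
  simpa [hφ0] using hlim

theorem omegaLimitSet_backward_invariant (hf : LocallyLipschitz f) (hφ0 : ∀ x, φ x 0 = x)
    (hφd : ∀ x t, 0 ≤ t → HasDerivAt (φ x) (f (φ x t)) t) {x₀ : E}
    (hbound : IsBounded (φ x₀ '' Ici (0 : ℝ))) {x : E} {t : ℝ} (ht : 0 ≤ t)
    (hx : φ x t ∈ omegaLimitSet φ x₀) : x ∈ omegaLimitSet φ x₀ := by
  obtain ⟨u, hu0, hu, hlim⟩ := hx
  have hev : ∀ᶠ k in atTop, t ≤ u k := hu.eventually_ge_atTop t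
  have hneg : LocallyLipschitz fun z => -f z := hf.neg
  have key : Tendsto (fun k => φ x₀ (u k - t)) atTop (𝓝 (φ x (t - t))) := by
    refine hneg.tendsto_endpoint ht (x := fun r => φ x (t - r)) (y := fun k r => φ x₀ (u k - r))
      (fun r hr => (hφd x (t - r) (sub_nonneg.2 hr.2)).comp_const_sub t r) hbound ?_ ?_ ?_
    · filter_upwards [hev] with k hk r hr
      exact (hφd x₀ (u k - r) (sub_nonneg.2 (hr.2.trans hk))).comp_const_sub (u k) r
    · filter_upwards [hev] with k hk r hr
      exact mem_image_of_mem _ (sub_nonneg.2 (hr.2.trans hk))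
    · simpa using hlim
  rw [sub_self, hφ0] at key
  have heq : ∀ᶠ k in atTop, u k - t = max (u k - t) 0 := by
    filter_upwards [hev] with k hk
    rw [max_eq_left (sub_nonneg.2 hk)]
  refine ⟨fun k => max (u k - t) 0, fun k => le_max_right _ _,
    (tendsto_atTop_add_const_right _ (-t) hu).congr' heq, key.congr' ?_⟩
  filter_upwards [heq] with k hk
  rw [← hk]

theorem omegaLimitSet_subset_closure_preorbit (hf : LocallyLipschitz f) (hφ0 : ∀ x, φ x 0 = x)
    (hφd : ∀ x t, 0 ≤ t → HasDerivAt (φ x) (f (φ x t)) t) {x₀ : E}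
    (hbound : IsBounded (φ x₀ '' Ici (0 : ℝ))) {V : E → ℝ} (hV : ContDiff ℝ 1 V) :
    omegaLimitSet φ x₀ ⊆ closure {x | ∃ t, 0 ≤ t ∧ φ x t ∈ {z | fderiv ℝ V z (f z) = 0}} := by
  intro y hy
  have hVd : ∀ x t, 0 ≤ t →
      HasDerivAt (fun t => V (φ x t)) (fderiv ℝ V (φ x t) (f (φ x t))) t := fun x t ht =>
    ((hV.differentiable one_ne_zero) (φ x t)).hasFDerivAt.comp_hasDerivAt t (hφd x t ht)
  by_cases hA : ∀ s, 0 ≤ s → ∃ t, 0 ≤ t ∧ φ (φ x₀ s) t ∈ {z | fderiv ℝ V z (f z) = 0}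
  · obtain ⟨u, hu0, -, hlim⟩ := hy
    exact mem_closure_of_tendsto hlim (Eventually.of_forall fun k => hA (u k) (hu0 k))
  push Not at hA
  obtain ⟨s, hs, hne⟩ := hA
  obtain ⟨c, hc⟩ : ∃ c, Tendsto (fun t => V (φ x₀ t)) atTop (𝓝 c) := by
    refine exists_tendsto_of_deriv_ne_zero_of_isBounded (s := s)
      (fun t ht => hVd x₀ t (hs.trans ht)) (fun t ht => ?_) ?_
    · have := hne (t - s) (sub_nonneg.2 ht)
      rwa [← semiflow_add hf hφ0 hφd x₀ hs (sub_nonneg.2 ht), add_sub_cancel] at this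
    · refine (hbound.isCompact_closure.image hV.continuous).isBounded.subset ?_
      rintro _ ⟨t, ht, rfl⟩
      exact mem_image_of_mem V (subset_closure (mem_image_of_mem _ (hs.trans ht)))
  have hconst : ∀ z ∈ omegaLimitSet φ x₀, V z = c := by
    rintro z ⟨u, -, hu, hlim⟩
    exact tendsto_nhds_unique ((hV.continuous.tendsto z).comp hlim) (hc.comp hu)
  refine subset_closure ⟨0, le_rfl, ?_⟩
  have h1 := (hVd y 0 le_rfl).hasDerivWithinAt (s := Ici 0)
  have h2 : HasDerivWithinAt (fun t => V (φ y t)) 0 (Ici 0) 0 :=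
    (hasDerivWithinAt_const (0 : ℝ) (Ici 0) c).congr
      (fun t ht => hconst _ (omegaLimitSet_forward_invariant hf hφ0 hφd hbound hy ht))
      (hconst _ (omegaLimitSet_forward_invariant hf hφ0 hφd hbound hy le_rfl))
  exact (uniqueDiffOn_Ici (0 : ℝ) 0 self_mem_Ici).eq_deriv _ h1 h2

end Semiflow

/-- Theorem 2 (second part): if the positive orbit of `x₀` is bounded, `V` is `C¹`,
`S = {x : ∇V(x)·f(x) = 0}` and `A = {x : ∃ t ≥ 0, φ(t,x) ∈ S}`, then the ω-limit set of
`x₀` is contained in the largest invariant set `M` contained in `closure A`. -/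
theorem omega_limit_subset_largest_invariant_in_closure_of_preorbit {n : ℕ}
    (f : EuclideanSpace ℝ (Fin n) → EuclideanSpace ℝ (Fin n))
    (hf : LocallyLipschitz f)
    (φ : EuclideanSpace ℝ (Fin n) → ℝ → EuclideanSpace ℝ (Fin n))
    (hφ0 : ∀ x, φ x 0 = x)
    (hφd : ∀ x t, 0 ≤ t → HasDerivAt (φ x) (f (φ x t)) t)
    (x₀ : EuclideanSpace ℝ (Fin n))
    (hbound : IsBounded (φ x₀ '' Ici (0:ℝ)))
    (V : EuclideanSpace ℝ (Fin n) → ℝ)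
    (hV : ContDiff ℝ 1 V) :
    omegaLimitSet φ x₀ ⊆
      ⋃₀ {I : Set (EuclideanSpace ℝ (Fin n)) |
        I ⊆ closure {x | ∃ t, 0 ≤ t ∧ φ x t ∈ {z | fderiv ℝ V z (f z) = 0}} ∧
        (∀ x ∈ I, ∀ t, 0 ≤ t → φ x t ∈ I) ∧
        (∀ x t, 0 ≤ t → φ x t ∈ I → x ∈ I)} := by
  exact fun y hy => ⟨omegaLimitSet φ x₀,
    ⟨omegaLimitSet_subset_closure_preorbit hf hφ0 hφd hbound hV,
      fun x hx t ht => omegaLimitSet_forward_invariant hf hφ0 hφd hbound hx ht,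
      fun x t ht hx => omegaLimitSet_backward_invariant hf hφ0 hφd hbound ht hx⟩, hy⟩
end

section
/- Let f : ℝⁿ → ℝⁿ be locally Lipschitz and suppose there exists a point x₀ ∈ ℝⁿ whose positive orbit γ⁺(x₀) = {φ(t, x₀) : t ≥ 0} under ẋ = f(x) is bounded. Then for every C¹ function V : ℝⁿ → ℝ the set S = {x ∈ ℝⁿ : ∇V(x)·f(x) = 0} is non-empty. -/
open Filter Topology Set Metric Bornology

/-- Along a solution of `ẋ = f(x)` with bounded positive orbit, a `C¹` function cannot have
everywhere positive orbital derivative. -/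
lemma not_forall_fderiv_pos_of_bounded_orbit {E : Type*} [NormedAddCommGroup E] [NormedSpace ℝ E]
    [ProperSpace E] {f : E → E} (hf : Continuous f) {γ : ℝ → E}
    (hγ : ∀ t, 0 ≤ t → HasDerivAt γ (f (γ t)) t) (hb : IsBounded (γ '' Ici (0 : ℝ)))
    {V : E → ℝ} (hV : ContDiff ℝ 1 V) : ¬ ∀ x, 0 < fderiv ℝ V x (f x) := by
  intro hpos
  have hcont : Continuous fun x => fderiv ℝ V x (f x) :=
    (hV.continuous_fderiv one_ne_zero).clm_apply hf
  have hK : IsCompact (closure (γ '' Ici (0 : ℝ))) := hb.isCompact_closure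
  have hmem : ∀ t, 0 ≤ t → γ t ∈ closure (γ '' Ici (0 : ℝ)) :=
    fun t ht => subset_closure ⟨t, ht, rfl⟩
  obtain ⟨x₁, -, hmin⟩ := hK.exists_isMinOn ⟨_, hmem 0 le_rfl⟩ hcont.continuousOn
  obtain ⟨x₂, -, hmax⟩ := hK.exists_isMaxOn ⟨_, hmem 0 le_rfl⟩ hV.continuous.continuousOn
  set c := fderiv ℝ V x₁ (f x₁)
  have hc : 0 < c := hpos x₁
  have hd : ∀ t, 0 ≤ t → HasDerivAt (fun s => V (γ s)) (fderiv ℝ V (γ t) (f (γ t))) t :=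
    fun t ht =>
      ((hV.differentiable one_ne_zero) (γ t)).hasFDerivAt.comp_hasDerivAt t (hγ t ht)
  have hgrowth : ∀ t, 0 ≤ t → c * (t - 0) ≤ V (γ t) - V (γ 0) := fun t ht =>
    (convex_Ici (0 : ℝ)).mul_sub_le_image_sub_of_le_deriv
      (fun s hs => (hd s hs).continuousAt.continuousWithinAt)
      (fun s hs => (hd s (interior_subset hs)).differentiableAt.differentiableWithinAt)
      (fun s hs => by
        rw [(hd s (interior_subset hs)).deriv]
        exact hmin (hmem s (interior_subset hs)))
      0 self_mem_Ici t ht ht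
  have h0 : V (γ 0) ≤ V x₂ := hmax (hmem 0 le_rfl)
  have hT : 0 ≤ (V x₂ - V (γ 0) + 1) / c := div_nonneg (by linarith) hc.le
  have hle : V (γ ((V x₂ - V (γ 0) + 1) / c)) ≤ V x₂ := hmax (hmem _ hT)
  have := hgrowth _ hT
  rw [sub_zero, mul_div_cancel₀ _ hc.ne'] at this
  linarith

/-- If some point `x₀` has a bounded positive orbit under the flow of the locally Lipschitz
vector field `f`, then for every `C¹` function `V : ℝⁿ → ℝ` the set
`S = {x : ∇V(x)·f(x) = 0}` is non-empty. -/
theorem zero_derivative_set_nonempty_of_bounded_orbit {n : ℕ}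
    (f : EuclideanSpace ℝ (Fin n) → EuclideanSpace ℝ (Fin n))
    (hf : LocallyLipschitz f)
    (φ : EuclideanSpace ℝ (Fin n) → ℝ → EuclideanSpace ℝ (Fin n))
    (hφ0 : ∀ x, φ x 0 = x)
    (hφd : ∀ x t, 0 ≤ t → HasDerivAt (φ x) (f (φ x t)) t)
    (hbound : ∃ x₀, IsBounded (φ x₀ '' Ici (0:ℝ))) :
    ∀ V : EuclideanSpace ℝ (Fin n) → ℝ, ContDiff ℝ 1 V →
      {x | fderiv ℝ V x (f x) = 0}.Nonempty := by
  intro V hV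
  obtain ⟨x₀, hb⟩ := hbound
  have hcont : Continuous fun x => fderiv ℝ V x (f x) :=
    (hV.continuous_fderiv one_ne_zero).clm_apply hf.continuous
  obtain ⟨a, ha⟩ := not_forall.1
    (not_forall_fderiv_pos_of_bounded_orbit hf.continuous (hφd x₀) hb hV)
  obtain ⟨b, hb'⟩ := not_forall.1
    (not_forall_fderiv_pos_of_bounded_orbit hf.continuous (hφd x₀) hb hV.neg)
  have hb₀ : 0 ≤ fderiv ℝ V b (f b) := by simpa [fderiv_fun_neg] using hb'
  exact mem_range_of_exists_le_of_exists_ge hcont ⟨a, not_lt.1 ha⟩ ⟨b, hb₀⟩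
end

section
/- Let f : ℝⁿ → ℝⁿ be locally Lipschitz and suppose that for every x₀ ∈ ℝⁿ the positive orbit γ⁺(x₀) = {φ(t, x₀) : t ≥ 0} under ẋ = f(x) is bounded. Let V : ℝⁿ → ℝ be C¹ and suppose the set S = {x ∈ ℝⁿ : ∇V(x)·f(x) = 0} is negatively invariant. Then for every x₀ ∈ ℝⁿ, ω(x₀) ⊆ S, i.e. S is a global attractor: dist(φ(t, x₀), S) → 0 as t → +∞ for every x₀ ∈ ℝⁿ. -/
open Filter Topology Set Metric Bornology

/-- Two forward solutions of an autonomous ODE with locally Lipschitz right-hand side that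
share their initial value agree on `[0, ∞)`. -/
lemma eqOn_Ici_of_locallyLipschitz {E : Type*} [NormedAddCommGroup E] [NormedSpace ℝ E]
    {f : E → E} (hf : LocallyLipschitz f) {γ η : ℝ → E}
    (hγ : ∀ t, 0 ≤ t → HasDerivAt γ (f (γ t)) t)
    (hη : ∀ t, 0 ≤ t → HasDerivAt η (f (η t)) t) (h₀ : γ 0 = η 0) :
    EqOn γ η (Ici 0) := by
  intro T hT
  have hcγ : ContinuousOn γ (Icc 0 T) := fun t ht => (hγ t ht.1).continuousAt.continuousWithinAt
  have hcη : ContinuousOn η (Icc 0 T) := fun t ht => (hη t ht.1).continuousAt.continuousWithinAt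
  obtain ⟨K, hK⟩ := hf.locallyLipschitzOn.exists_lipschitzOnWith_of_compact
    ((isCompact_Icc.image_of_continuousOn hcγ).union (isCompact_Icc.image_of_continuousOn hcη))
  exact ODE_solution_unique_of_mem_Icc_right (v := fun _ => f)
    (s := fun _ => γ '' Icc 0 T ∪ η '' Icc 0 T) (fun _ _ => hK)
    hcγ (fun t ht => (hγ t ht.1).hasDerivWithinAt)
    (fun t ht => Or.inl (mem_image_of_mem _ (Ico_subset_Icc_self ht)))
    hcη (fun t ht => (hη t ht.1).hasDerivWithinAt)
    (fun t ht => Or.inr (mem_image_of_mem _ (Ico_subset_Icc_self ht))) h₀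
    (right_mem_Icc.2 hT)

/-- A forward flow of an autonomous ODE with locally Lipschitz right-hand side satisfies the
semigroup law. -/
lemma flow_flow_eq_flow_add {E : Type*} [NormedAddCommGroup E] [NormedSpace ℝ E]
    {f : E → E} (hf : LocallyLipschitz f) {φ : E → ℝ → E} (hφ0 : ∀ x, φ x 0 = x)
    (hφd : ∀ x t, 0 ≤ t → HasDerivAt (φ x) (f (φ x t)) t) (x : E) {s t : ℝ}
    (hs : 0 ≤ s) (ht : 0 ≤ t) : φ (φ x s) t = φ x (s + t) :=
  eqOn_Ici_of_locallyLipschitz hf (hφd _)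
    (fun r hr => (hφd x (s + r) (add_nonneg hs hr)).comp_const_add s r)
    (by simp [hφ0]) ht

/-- A real function that is monotone and bounded above on some `[T, ∞)` converges at `+∞`. -/
lemma MonotoneOn.exists_tendsto_atTop {h : ℝ → ℝ} {T B : ℝ} (hm : MonotoneOn h (Ici T))
    (hB : ∀ t, T ≤ t → h t ≤ B) : ∃ c, Tendsto h atTop (𝓝 c) := by
  have hmono : Monotone fun t => h (max t T) := fun a b hab =>
    hm (mem_Ici.2 (le_max_right _ _)) (mem_Ici.2 (le_max_right _ _)) (max_le_max_right _ hab)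
  refine ⟨_, (tendsto_atTop_ciSup hmono
    ⟨B, forall_mem_range.2 fun t => hB _ (le_max_right t T)⟩).congr' ?_⟩
  filter_upwards [eventually_ge_atTop T] with t ht
  rw [max_eq_left ht]

/-- A real function that is bounded with nonvanishing derivative on some `[T, ∞)` converges
at `+∞`. -/
lemma exists_tendsto_atTop_of_hasDerivAt_ne_zero {h h' : ℝ → ℝ} {T B : ℝ}
    (hd : ∀ t, T ≤ t → HasDerivAt h (h' t) t) (hB : ∀ t, T ≤ t → |h t| ≤ B)
    (hne : ∀ t, T ≤ t → h' t ≠ 0) : ∃ c, Tendsto h atTop (𝓝 c) := by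
  have key : ∀ g g' : ℝ → ℝ, (∀ t, T ≤ t → HasDerivAt g (g' t) t) →
      (∀ t, T ≤ t → g t ≤ B) → (∀ t, T ≤ t → 0 < g' t) → ∃ c, Tendsto g atTop (𝓝 c) := by
    intro g g' hg hgB hpos
    refine MonotoneOn.exists_tendsto_atTop (monotoneOn_of_deriv_nonneg (convex_Ici T)
      (fun t ht => (hg t ht).continuousAt.continuousWithinAt) ?_ ?_) hgB
    · exact fun t ht => (hg t (interior_subset ht)).differentiableAt.differentiableWithinAt
    · intro t ht
      rw [(hg t (interior_subset ht)).deriv]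
      exact (hpos t (interior_subset ht)).le
  rcases hasDerivWithinAt_forall_lt_or_forall_gt_of_forall_ne (convex_Ici T)
    (fun t ht => (hd t ht).hasDerivWithinAt) hne with hlt | hgt
  · obtain ⟨c, hc⟩ := key (fun t => -h t) (fun t => -h' t) (fun t ht => (hd t ht).fun_neg)
      (fun t ht => (neg_le_abs _).trans (hB t ht)) (fun t ht => neg_pos.2 (hlt t ht))
    exact ⟨-c, by simpa using hc.neg⟩
  · exact key h h' hd (fun t ht => (le_abs_self _).trans (hB t ht)) hgt

/-- Along a Lipschitz curve `γ`, if `h` converges at `+∞` and has derivative `g ∘ γ` with `g`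
continuous, then `g` vanishes at every limit point of `γ`. -/
lemma eq_zero_of_tendsto_of_hasDerivAt_comp {E : Type*} [PseudoMetricSpace E] {γ : ℝ → E}
    {g : E → ℝ} (hg : Continuous g) {h : ℝ → ℝ}
    (hd : ∀ t, 0 ≤ t → HasDerivAt h (g (γ t)) t) {K : NNReal} (hγ : LipschitzOnWith K γ (Ici 0))
    {c : ℝ} (hc : Tendsto h atTop (𝓝 c)) {u : ℕ → ℝ} (hu : Tendsto u atTop atTop) {y : E}
    (hy : Tendsto (fun k => γ (u k)) atTop (𝓝 y)) : g y = 0 := by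
  by_contra hne
  have hpos : 0 < |g y| / 2 := by positivity
  obtain ⟨r, hr, hball⟩ := Metric.continuousAt_iff.1 hg.continuousAt _ hpos
  obtain ⟨δ, hδ, hKδ⟩ : ∃ δ : ℝ, 0 < δ ∧ K * δ < r / 2 := by
    have hK : (0 : ℝ) < K + 1 := by positivity
    refine ⟨r / 2 / (K + 1), by positivity, ?_⟩
    rw [← mul_div_assoc, div_lt_iff₀ hK]
    nlinarith
  have hdiff : Tendsto (fun k => h (u k + δ) - h (u k)) atTop (𝓝 0) := by
    simpa using (hc.comp (tendsto_atTop_add_const_right _ δ hu)).sub (hc.comp hu)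
  obtain ⟨k, hk0, hkd, hky⟩ := ((hu.eventually_ge_atTop 0).and
    ((Metric.tendsto_nhds.1 hdiff _ (mul_pos hpos hδ)).and
      (Metric.tendsto_nhds.1 hy _ (half_pos hr)))).exists
  obtain ⟨θ, hθ, hslope⟩ := exists_hasDerivAt_eq_slope h (fun t => g (γ t))
    (lt_add_of_pos_right (u k) hδ)
    (fun t ht => (hd t (hk0.trans ht.1)).continuousAt.continuousWithinAt)
    (fun t ht => hd t (hk0.trans ht.1.le))
  have hdist : dist (γ θ) (γ (u k)) ≤ K * δ := by
    refine (hγ.dist_le_mul θ (hk0.trans hθ.1.le) (u k) hk0).trans ?_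
    gcongr
    rw [Real.dist_eq, abs_of_pos (sub_pos.2 hθ.1)]
    linarith [hθ.2]
  have hclose : |g (γ θ) - g y| < |g y| / 2 :=
    hball ((dist_triangle _ (γ (u k)) _).trans_lt (by linarith))
  have hsmall : |g (γ θ)| < |g y| / 2 := by
    rw [hslope, add_sub_cancel_left, abs_div, abs_of_pos hδ, div_lt_iff₀ hδ]
    simpa [Real.dist_eq] using hkd
  have := abs_sub_abs_le_abs_sub (g y) (g (γ θ))
  rw [abs_sub_comm] at this
  linarith

/-- If every positive orbit is bounded and the set `S = {x : ∇V(x)·f(x) = 0}` is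
negatively invariant, then `ω(x₀) ⊆ S` for every `x₀`, and `S` is a global attractor:
`dist(φ(t,x₀), S) → 0` as `t → +∞` for every `x₀`. -/
theorem zero_derivative_set_global_attractor {n : ℕ}
    (f : EuclideanSpace ℝ (Fin n) → EuclideanSpace ℝ (Fin n))
    (hf : LocallyLipschitz f)
    (φ : EuclideanSpace ℝ (Fin n) → ℝ → EuclideanSpace ℝ (Fin n))
    (hφ0 : ∀ x, φ x 0 = x)
    (hφd : ∀ x t, 0 ≤ t → HasDerivAt (φ x) (f (φ x t)) t)
    (hbound : ∀ x₀, IsBounded (φ x₀ '' Ici (0:ℝ)))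
    (V : EuclideanSpace ℝ (Fin n) → ℝ)
    (hV : ContDiff ℝ 1 V)
    (hSneg : ∀ x t, 0 ≤ t → φ x t ∈ {z | fderiv ℝ V z (f z) = 0} →
      x ∈ {z | fderiv ℝ V z (f z) = 0}) :
    ∀ x₀ : EuclideanSpace ℝ (Fin n),
      omegaLimitSet φ x₀ ⊆ {z | fderiv ℝ V z (f z) = 0} ∧
      Tendsto (fun t : ℝ => infDist (φ x₀ t) {z | fderiv ℝ V z (f z) = 0})
        atTop (𝓝 0) := by
  set g : EuclideanSpace ℝ (Fin n) → ℝ := fun z => fderiv ℝ V z (f z)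
  have hg : Continuous g := (hV.continuous_fderiv one_ne_zero).clm_apply hf.continuous
  intro x₀
  have hK : IsCompact (closure (φ x₀ '' Ici 0)) := (hbound x₀).isCompact_closure
  have hmem : ∀ t, 0 ≤ t → φ x₀ t ∈ closure (φ x₀ '' Ici 0) := fun t ht =>
    subset_closure (mem_image_of_mem _ ht)
  have hd : ∀ t, 0 ≤ t → HasDerivAt (fun t => V (φ x₀ t)) (g (φ x₀ t)) t := fun t ht =>
    (hV.differentiable one_ne_zero _).hasFDerivAt.comp_hasDerivAt t (hφd x₀ t ht)
  have hlim : ∀ (u : ℕ → ℝ) y, Tendsto u atTop atTop →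
      Tendsto (fun k => φ x₀ (u k)) atTop (𝓝 y) → g y = 0 := by
    intro u y hu hy
    by_cases hzero : ∀ t, 0 ≤ t → g (φ x₀ t) = 0
    · refine tendsto_nhds_unique ((hg.tendsto y).comp hy) (tendsto_const_nhds.congr' ?_)
      filter_upwards [hu.eventually_ge_atTop 0] with k hk using (hzero _ hk).symm
    · push Not at hzero
      obtain ⟨T, hT, hgT⟩ := hzero
      have hne : ∀ t, T ≤ t → g (φ x₀ t) ≠ 0 := by
        intro t ht h0
        refine hgT (hSneg (φ x₀ T) (t - T) (sub_nonneg.2 ht) ?_)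
        rwa [flow_flow_eq_flow_add hf hφ0 hφd x₀ hT (sub_nonneg.2 ht), add_sub_cancel]
      obtain ⟨B, hB⟩ := hK.exists_bound_of_continuousOn hV.continuous.continuousOn
      obtain ⟨c, hc⟩ := exists_tendsto_atTop_of_hasDerivAt_ne_zero
        (fun t ht => hd t (hT.trans ht)) (fun t ht => hB _ (hmem t (hT.trans ht))) hne
      obtain ⟨M, hM⟩ := hK.exists_bound_of_continuousOn hf.continuous.continuousOn
      have hLip : LipschitzOnWith M.toNNReal (φ x₀) (Ici 0) :=
        (convex_Ici (0 : ℝ)).lipschitzOnWith_of_nnnorm_hasDerivWithin_le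
          (fun t ht => (hφd x₀ t ht).hasDerivWithinAt)
          (fun t ht => NNReal.le_toNNReal_of_coe_le (hM _ (hmem t ht)))
      exact eq_zero_of_tendsto_of_hasDerivAt_comp hg hd hLip hc hu hy
  refine ⟨fun y ⟨u, _, hu, hy⟩ => hlim u y hu hy, tendsto_of_subseq_tendsto fun u hu => ?_⟩
  obtain ⟨y, -, ψ, hψ, hy⟩ := hK.tendsto_subseq'
    ((hu.eventually_ge_atTop 0).mono fun k hk => hmem _ hk).frequently
  refine ⟨ψ, ?_⟩
  have hyS : y ∈ {z | g z = 0} := hlim (u ∘ ψ) y (hu.comp hψ.tendsto_atTop) hy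
  have hdist := ((continuous_infDist_pt {z | g z = 0}).tendsto y).comp hy
  rwa [infDist_zero_of_mem hyS] at hdist
end
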